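/- Let v ∈ S^{n-1} and consider the map F : v^⊥ → S^{n-1} defined by F(x) = (x+v)/‖x+v‖. Then the Jacobian (the (n-1)-dimensional area distortion factor) of F at x ∈ v^⊥ equals (1 + ‖x‖²)^{-n/2}. -/

import Mathlib

open MeasureTheory Set
open scoped RealInnerProductSpace

open Topology NNReal ENNReal in
lemma aux_compare {X Y Z : Type*} [MetricSpace X] [MetricSpace Y]
    [MeasurableSpace X] [BorelSpace X] [MeasurableSpace Y] [BorelSpace Y]
    (f : Z → X) (g : Z → Y) (B : Set Z) (t : ℝ≥0) (d : ℝ) (hd : 0 ≤ d)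
    (h : ∀ x ∈ B, ∀ y ∈ B, dist (f x) (f y) ≤ t * dist (g x) (g y)) :
    μH[d] (f '' B) ≤ (t : ℝ≥0∞) ^ d * μH[d] (g '' B) := by
  rcases B.eq_empty_or_nonempty with rfl | ⟨b, hb⟩
  · simp
  have : Nonempty Z := ⟨b⟩
  set k : Y → X := fun y => f (Function.invFunOn g B y) with hk
  have hmem : ∀ y ∈ g '' B, Function.invFunOn g B y ∈ B ∧ g (Function.invFunOn g B y) = y :=
    fun y hy => ⟨Function.invFunOn_mem hy, Function.invFunOn_eq hy⟩
  have hlip : LipschitzOnWith t k (g '' B) := by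
    apply LipschitzOnWith.of_dist_le_mul
    intro y hy z hz
    have := h _ (hmem y hy).1 _ (hmem z hz).1
    rwa [(hmem y hy).2, (hmem z hz).2] at this
  have himg : k '' (g '' B) = f '' B := by
    rw [image_image]
    apply image_congr
    intro x hx
    have h1 := hmem (g x) (mem_image_of_mem g hx)
    have := h _ h1.1 x hx
    rw [h1.2, dist_self, mul_zero] at this
    exact dist_le_zero.1 this
  rw [← himg]
  exact hlip.hausdorffMeasure_image_le hd

open Topology NNReal ENNReal in
lemma aux_bilip {H E : Type*} [NormedAddCommGroup H] [NormedSpace ℝ H] [FiniteDimensional ℝ H]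
    [NormedAddCommGroup E] [NormedSpace ℝ E] (f : H → E) (L : H →L[ℝ] E) (M : H →ₗ[ℝ] H)
    (x₀ : H) (hf : HasStrictFDerivAt f L x₀) (hM : LinearMap.det M ≠ 0)
    (hLM : ∀ u, ‖L u‖ = ‖M u‖) (t : ℝ) (ht : 1 < t) :
    ∃ U ∈ 𝓝 x₀, ∀ x ∈ U, ∀ y ∈ U, dist (f x) (f y) ≤ t * dist (M x) (M y) ∧
      dist (M x) (M y) ≤ t * dist (f x) (f y) := by
  obtain ⟨K, hK, hKM⟩ : ∃ K : ℝ, 0 < K ∧ ∀ u, ‖u‖ ≤ K * ‖M u‖ := by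
    let e := (LinearMap.equivOfDetNeZero M hM).toContinuousLinearEquiv
    obtain ⟨K, hK, h⟩ := (e.symm : H →L[ℝ] H).bound
    refine ⟨K, hK, fun u => ?_⟩
    have h2 := h (e u)
    have h3 : e u = M u := rfl
    rw [← h3]
    simpa using h2
  have hε : 0 < (1 - 1/t) / K := by
    apply div_pos _ hK
    rw [sub_pos, div_lt_one (by linarith)]; exact ht
  have h1 := (hf.isLittleO.def hε)
  rw [nhds_prod_eq] at h1
  replace h1 := (Filter.eventually_prod_self_iff (r := fun a b : H =>
    ‖f a - f b - L (a - b)‖ ≤ (1 - 1 / t) / K * ‖a - b‖)).1 h1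
  obtain ⟨U, hU, hUU⟩ := h1
  refine ⟨U, hU, fun x hx y hy => ?_⟩
  have h2 := hUU x hx y hy
  have h3 : ‖f x - f y - L (x - y)‖ ≤ (1 - 1/t) * ‖M (x - y)‖ := by
    refine h2.trans ?_
    calc _ ≤ (1 - 1/t) / K * (K * ‖M (x - y)‖) := by gcongr; exact hKM _
      _ = _ := by field_simp
  rw [dist_eq_norm, dist_eq_norm, ← map_sub]
  have h4 := norm_sub_norm_le (f x - f y) (L (x - y))
  have h5 := norm_sub_norm_le (L (x - y)) (f x - f y)
  rw [norm_sub_rev (L (x - y))] at h5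
  rw [hLM] at h4 h5
  have h0 : 0 ≤ ‖M (x - y)‖ := norm_nonneg _
  have ht0 : 0 < t := by linarith
  constructor
  · have : 2 - 1/t ≤ t := by
      rw [sub_le_iff_le_add, ← sub_nonneg]
      have : t + 1/t - 2 = (t-1)^2/t := by field_simp; ring
      rw [this]; positivity
    nlinarith
  · have : (1/t) * ‖M (x - y)‖ ≤ ‖f x - f y‖ := by linarith
    rw [div_mul_eq_mul_div, one_mul, div_le_iff₀ ht0] at this
    linarith

open Topology NNReal ENNReal in
lemma aux_glob {X : Type*} [TopologicalSpace X] [SecondCountableTopology X] [MeasurableSpace X]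
    [BorelSpace X] (μ ν : Measure X) (c : ℝ≥0∞)
    (h : ∀ x, ∃ U ∈ 𝓝 x, ∀ B ⊆ U, MeasurableSet B → μ B ≤ c * ν B) : μ ≤ c • ν := by
  choose U hU hUB using h
  obtain ⟨s, hs, hsU⟩ := TopologicalSpace.countable_cover_nhds (f := fun x => interior (U x))
    (fun x => interior_mem_nhds.2 (hU x))
  rcases s.eq_empty_or_nonempty with rfl | hne
  · have : IsEmpty X := by simpa using (univ_eq_empty_iff.1 (by simpa using hsU.symm))
    intro B
    simp [Subsingleton.elim B ∅]
  obtain ⟨a, rfl⟩ := hs.exists_eq_range hne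
  rw [Measure.le_iff]
  intro B hB
  have hcov : ⋃ i, interior (U (a i)) = univ := by simpa using hsU
  set W := disjointed (fun i => interior (U (a i))) with hW
  have hWm : ∀ i, MeasurableSet (W i) := fun i =>
    MeasurableSet.disjointed (fun i => isOpen_interior.measurableSet) i
  have hWd : Pairwise (Function.onFun Disjoint fun i => B ∩ W i) := fun i j hij =>
    (disjoint_disjointed _ hij).mono inter_subset_right inter_subset_right
  have hBW : B = ⋃ i, B ∩ W i := by
    rw [← inter_iUnion, hW, iUnion_disjointed, hcov, inter_univ]
  rw [Measure.smul_apply, smul_eq_mul, hBW, measure_iUnion hWd (fun i => hB.inter (hWm i)),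
    measure_iUnion hWd (fun i => hB.inter (hWm i)), ← ENNReal.tsum_mul_left]
  refine ENNReal.tsum_le_tsum fun i => ?_
  exact hUB (a i) _ (inter_subset_right.trans ((disjointed_subset _ i).trans interior_subset))
    (hB.inter (hWm i))

open Topology NNReal ENNReal in
lemma aux_lim (a b : ℝ≥0∞) (d : ℝ) (h : ∀ t : ℝ≥0, 1 < t → a ≤ (t : ℝ≥0∞) ^ d * t * b) :
    a ≤ b := by
  have h1 : Filter.Tendsto (fun t : ℝ≥0 => (t : ℝ≥0∞) ^ d * t * b) (𝓝[>] 1) (𝓝 ((1:ℝ≥0∞) ^ d * 1 * b)) := by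
    have hc : Filter.Tendsto (fun t : ℝ≥0 => (t : ℝ≥0∞)) (𝓝[>] 1) (𝓝 1) := by
      have := (ENNReal.continuous_coe.tendsto (1:ℝ≥0)).mono_left (nhdsWithin_le_nhds (s := Ioi 1))
      simpa using this
    refine ENNReal.Tendsto.mul_const (ENNReal.Tendsto.mul ?_ ?_ hc ?_) ?_
    · exact (ENNReal.continuous_rpow_const.tendsto _).comp hc
    all_goals simp
  simp only [ENNReal.one_rpow, one_mul] at h1
  exact ge_of_tendsto h1 (by filter_upwards [self_mem_nhdsWithin] with t ht using h t ht)

open Topology NNReal ENNReal in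
lemma aux_area {H E : Type*} [NormedAddCommGroup H] [NormedSpace ℝ H] [FiniteDimensional ℝ H]
    [MeasurableSpace H] [BorelSpace H] [MeasurableSpace E]
    [NormedAddCommGroup E] [NormedSpace ℝ E] [BorelSpace E] (f : H → E)
    (L : H → H →L[ℝ] E) (M : H → H →ₗ[ℝ] H) (J : H → ℝ)
    (hinj : Function.Injective f)
    (hf : ∀ x, HasStrictFDerivAt f (L x) x) (hM : ∀ x, LinearMap.det (M x) = J x)
    (hJ : ∀ x, 0 < J x) (hJc : Continuous J)
    (hLM : ∀ x u, ‖L x u‖ = ‖M x u‖) (B : Set H) (hB : MeasurableSet B) :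
    μH[(Module.finrank ℝ H : ℝ)] (f '' B) =
      ∫⁻ x in B, ENNReal.ofReal (J x) ∂μH[(Module.finrank ℝ H : ℝ)] := by
  set d : ℝ := (Module.finrank ℝ H : ℝ) with hd
  have hd0 : 0 ≤ d := by positivity
  have : ProperSpace H := FiniteDimensional.proper ℝ H
  have hcont : Continuous f := continuous_iff_continuousAt.2 fun x => (hf x).continuousAt
  have hemb : MeasurableEmbedding f := hcont.measurableEmbedding hinj
  set m : Measure H := Measure.comap f μH[d] with hm
  set D : Measure H := (μH[d] : Measure H).withDensity (fun x => ENNReal.ofReal (J x)) with hD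
  have hmB : ∀ B, m B = μH[d] (f '' B) := fun B => hemb.comap_apply _ _
  have key : ∀ t : ℝ≥0, 1 < t → ∀ x, ∃ U ∈ 𝓝 x, ∀ B ⊆ U, MeasurableSet B →
      m B ≤ (t:ℝ≥0∞) ^ d * t * D B ∧ D B ≤ (t:ℝ≥0∞) ^ d * t * m B := by
    intro t ht x₀
    obtain ⟨U, hU, hUf⟩ := aux_bilip f (L x₀) (M x₀) x₀ (hf x₀) (by rw [hM]; exact (hJ x₀).ne')
      (hLM x₀) t (by exact_mod_cast ht)
    have ht' : (1:ℝ) < t := by exact_mod_cast ht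
    have e1 : ∀ᶠ x in 𝓝 x₀, J x < t * J x₀ :=
      hJc.continuousAt.eventually_lt continuousAt_const (by nlinarith [hJ x₀])
    have e2 : ∀ᶠ x in 𝓝 x₀, J x₀ < t * J x :=
      continuousAt_const.eventually_lt (hJc.continuousAt.const_mul _) (by nlinarith [hJ x₀])
    refine ⟨U ∩ {x | J x < t * J x₀ ∧ J x₀ < t * J x}, Filter.inter_mem hU (e1.and e2), ?_⟩
    intro B hBU hB
    have hdet : μH[d] (M x₀ '' B) = ENNReal.ofReal (J x₀) * μH[d] B := by
      rw [Measure.addHaar_image_linearMap, hM, abs_of_pos (hJ x₀)]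
    have c1 := aux_compare f (M x₀) B t d hd0 fun x hx y hy =>
      (hUf x (hBU hx).1 y (hBU hy).1).1
    have c2 := aux_compare (M x₀) f B t d hd0 fun x hx y hy =>
      (hUf x (hBU hx).1 y (hBU hy).1).2
    rw [hdet, ← hmB] at c1 c2
    have hDB : D B = ∫⁻ x in B, ENNReal.ofReal (J x) ∂μH[d] := withDensity_apply _ hB
    have d1 : ENNReal.ofReal (J x₀) * μH[d] B ≤ t * D B := by
      rw [hDB, ← lintegral_const_mul' _ _ (by simp), ← setLIntegral_const]
      refine setLIntegral_mono' hB fun x hx => ?_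
      rw [← ENNReal.ofReal_coe_nnreal, ← ENNReal.ofReal_mul (by positivity)]
      exact ENNReal.ofReal_le_ofReal (hBU hx).2.2.le
    have d2 : D B ≤ t * (ENNReal.ofReal (J x₀) * μH[d] B) := by
      rw [hDB, ← mul_assoc, ← setLIntegral_const]
      refine setLIntegral_mono' hB fun x hx => ?_
      rw [← ENNReal.ofReal_coe_nnreal, ← ENNReal.ofReal_mul (by positivity)]
      exact ENNReal.ofReal_le_ofReal (hBU hx).2.1.le
    constructor
    · calc _ ≤ _ := c1
        _ ≤ (t:ℝ≥0∞) ^ d * (t * D B) := by gcongr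
        _ = _ := by ring
    · calc _ ≤ _ := d2
        _ ≤ (t:ℝ≥0∞) * ((t:ℝ≥0∞) ^ d * m B) := by gcongr
        _ = _ := by ring
  rw [← hmB, ← withDensity_apply _ hB]
  apply le_antisymm
  · refine aux_lim _ _ d fun t ht => ?_
    refine aux_glob m D _ (fun x => ?_) B
    obtain ⟨U, hU, h⟩ := key t ht x
    exact ⟨U, hU, fun B hBU hB => (h B hBU hB).1⟩
  · refine aux_lim _ _ d fun t ht => ?_
    refine aux_glob D m _ (fun x => ?_) B
    obtain ⟨U, hU, h⟩ := key t ht x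
    exact ⟨U, hU, fun B hBU hB => (h B hBU hB).2⟩

lemma aux_deriv {E : Type*} [NormedAddCommGroup E] [InnerProductSpace ℝ E] (v : E)
    (x : (Submodule.span ℝ {v})ᗮ) :
    ∃ L : (Submodule.span ℝ {v})ᗮ →L[ℝ] E,
      HasStrictFDerivAt (fun x : (Submodule.span ℝ {v})ᗮ =>
        (√(1 + ‖x‖ ^ 2))⁻¹ • ((x : E) + v)) L x ∧
      ∀ u, L u = (√(1 + ‖x‖ ^ 2))⁻¹ • (u : E)
        - (((√(1 + ‖x‖ ^ 2))⁻¹) ^ 3 * ⟪x, u⟫) • ((x : E) + v) := by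
  have hs : 0 < 1 + ‖x‖ ^ 2 := by positivity
  have h1 := (hasStrictFDerivAt_norm_sq x).const_add 1
  have h2 := (hasStrictDerivAt_inv (Real.sqrt_pos.2 hs).ne').comp_hasStrictFDerivAt x
    ((Real.hasStrictDerivAt_sqrt hs.ne').comp_hasStrictFDerivAt x h1)
  have h3 := ((Submodule.span ℝ {v})ᗮ.subtypeL.hasStrictFDerivAt (x := x)).add_const v
  refine ⟨_, h2.smul h3, fun u => ?_⟩
  have hr : √(1 + ‖x‖ ^ 2) ≠ 0 := (Real.sqrt_pos.2 hs).ne'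
  have hi : ∀ s i : ℝ, (s ^ 2)⁻¹ * (s⁻¹ * 2⁻¹ * (2 * i)) = (s ^ 3)⁻¹ * i := by
    intro s i
    rw [pow_succ s 2, mul_inv]
    ring
  simp [sub_eq_add_neg, ← neg_smul, hi]
  abel

lemma aux_M {H : Type*} [NormedAddCommGroup H] [InnerProductSpace ℝ H] [FiniteDimensional ℝ H]
    (x : H) : ∃ M : H →ₗ[ℝ] H,
      LinearMap.det M = ((√(1 + ‖x‖ ^ 2))⁻¹) ^ (Module.finrank ℝ H + 1) ∧
      ∀ u, ‖M u‖ ^ 2 = ((√(1 + ‖x‖ ^ 2))⁻¹) ^ 2 * ‖u‖ ^ 2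
        - ((√(1 + ‖x‖ ^ 2))⁻¹) ^ 4 * ⟪x, u⟫ ^ 2 := by
  set r := √(1 + ‖x‖ ^ 2) with hr
  have hs : 0 < 1 + ‖x‖ ^ 2 := by positivity
  have hr0 : 0 < r := Real.sqrt_pos.2 hs
  have hr2 : ‖x‖ ^ 2 = r ^ 2 - 1 := by rw [hr, Real.sq_sqrt hs.le]; ring
  set c : ℝ := 1 / (r * (r + 1)) with hc
  refine ⟨r⁻¹ • LinearMap.transvection ((-c) • (innerSL ℝ x).toLinearMap) x, ?_, fun u => ?_⟩
  · rw [LinearMap.det_smul, LinearMap.transvection.det, pow_succ]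
    congr 1
    simp only [LinearMap.smul_apply, ContinuousLinearMap.coe_coe, innerSL_apply_apply,
      real_inner_self_eq_norm_sq, hr2, hc, smul_eq_mul]
    field_simp
    ring
  · have : (r⁻¹ • LinearMap.transvection ((-c) • (innerSL ℝ x).toLinearMap) x) u
        = r⁻¹ • (u - (c * ⟪x, u⟫) • x) := by
      simp [LinearMap.transvection.apply, sub_eq_add_neg]
    rw [this, norm_smul, mul_pow, norm_sub_sq_real, norm_smul, mul_pow, hr2, inner_smul_right,
      real_inner_comm, hc]
    simp only [Real.norm_eq_abs, sq_abs]
    field_simp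
    ring

theorem stmt_5 (n : ℕ) (hn : 2 ≤ n) (v : EuclideanSpace ℝ (Fin n)) (hv : ‖v‖ = 1)
    (A : Set (EuclideanSpace ℝ (Fin n))) (hA : MeasurableSet A)
    (hAv : ∀ x ∈ A, ⟪x, v⟫ = 0) :
    μH[(n:ℝ)-1] ((fun x => ‖x + v‖⁻¹ • (x + v)) '' A)
      = ∫⁻ x in A, ENNReal.ofReal ((1 + ‖x‖^2) ^ (-(n:ℝ)/2)) ∂μH[(n:ℝ)-1] := by
  set H := (Submodule.span ℝ {v})ᗮ with hH
  have hv0 : v ≠ 0 := by rintro rfl; simp at hv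
  obtain ⟨k, rfl⟩ : ∃ k, n = k + 1 := ⟨n - 1, by omega⟩
  have hfin : Module.finrank ℝ H = k := by
    have : Fact (Module.finrank ℝ (EuclideanSpace ℝ (Fin (k+1))) = k + 1) := ⟨by simp⟩
    exact Submodule.finrank_orthogonal_span_singleton hv0
  have hdim : ((k + 1 : ℕ) : ℝ) - 1 = (Module.finrank ℝ H : ℝ) := by rw [hfin]; push_cast; ring
  have hinner : ∀ x : H, ⟪(x : EuclideanSpace ℝ (Fin (k+1))), v⟫ = 0 := fun x =>
    Submodule.mem_orthogonal_singleton_iff_inner_left.1 x.2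
  have hnorm : ∀ x : H, ‖(x : EuclideanSpace ℝ (Fin (k+1))) + v‖ ^ 2 = 1 + ‖x‖ ^ 2 := fun x => by
    rw [norm_add_sq_real, hinner, hv, Submodule.coe_norm]; ring
  have hnorm' : ∀ x : H, ‖(x : EuclideanSpace ℝ (Fin (k+1))) + v‖ = √(1 + ‖x‖ ^ 2) := fun x => by
    rw [← hnorm, Real.sqrt_sq (norm_nonneg _)]
  have hpos : ∀ x : H, 0 < √(1 + ‖x‖ ^ 2) := fun x => Real.sqrt_pos.2 (by positivity)
  set F : H → EuclideanSpace ℝ (Fin (k+1)) := fun x => (√(1 + ‖x‖ ^ 2))⁻¹ • ((x : EuclideanSpace ℝ (Fin (k+1))) + v) with hF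
  set B : Set H := Subtype.val ⁻¹' A with hB
  have hBm : MeasurableSet B := measurable_subtype_coe hA
  have hAB : A = Subtype.val '' B := by
    ext x
    constructor
    · intro hx
      exact ⟨⟨x, Submodule.mem_orthogonal_singleton_iff_inner_left.2 (hAv x hx)⟩, hx, rfl⟩
    · rintro ⟨y, hy, rfl⟩
      exact hy
  have hinj : Function.Injective F := by
    intro x y hxy
    have e : ∀ z : H, ⟪F z, v⟫ = (√(1 + ‖z‖ ^ 2))⁻¹ := fun z => by
      rw [hF]; simp only
      rw [real_inner_smul_left, inner_add_left, hinner, real_inner_self_eq_norm_sq, hv]; ring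
    have h1 : (√(1 + ‖x‖ ^ 2))⁻¹ = (√(1 + ‖y‖ ^ 2))⁻¹ := by rw [← e, ← e, hxy]
    simp only [hF] at hxy
    rw [h1] at hxy
    have := smul_right_injective _ (inv_pos.2 (hpos y)).ne' hxy
    exact Subtype.ext (add_right_cancel this)
  choose L hL hLu using fun x : H => aux_deriv v x
  choose M hM hMu using fun x : H => aux_M x
  have key := aux_area F L M (fun x => ((√(1 + ‖x‖ ^ 2))⁻¹) ^ (Module.finrank ℝ H + 1)) hinj hL hM
    (fun x => pow_pos (inv_pos.2 (hpos x)) _)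
    (Continuous.pow (Continuous.inv₀ (by fun_prop) fun x => (hpos x).ne') _)
    (fun x u => by
      rw [← sq_eq_sq₀ (norm_nonneg _) (norm_nonneg _), hMu, hLu, norm_sub_sq_real, norm_smul,
        norm_smul, mul_pow, mul_pow, hnorm, real_inner_smul_left, real_inner_smul_right,
        inner_add_right, hinner, real_inner_comm (x : EuclideanSpace ℝ (Fin (k+1)))]
      have h2 : ⟪(x : EuclideanSpace ℝ (Fin (k+1))), (u : EuclideanSpace ℝ (Fin (k+1)))⟫ = ⟪x, u⟫ := rfl
      have h3 : 1 + ‖x‖ ^ 2 = √(1 + ‖x‖ ^ 2) ^ 2 := (Real.sq_sqrt (by positivity)).symm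
      have := (hpos x).ne'
      set r := √(1 + ‖x‖ ^ 2)
      rw [h2, h3, Submodule.coe_norm]
      simp only [Real.norm_eq_abs, sq_abs]
      field_simp
      ring) B hBm
  have himg : (fun x => ‖x + v‖⁻¹ • (x + v)) '' A = F '' B := by
    rw [hAB, image_image]
    apply image_congr
    intro x _
    simp only [hF, hnorm']
  have hiso : Isometry (Subtype.val : H → EuclideanSpace ℝ (Fin (k+1))) := isometry_subtype_coe
  have hme : MeasurableEmbedding (Subtype.val : H → EuclideanSpace ℝ (Fin (k+1))) :=
    hiso.continuous.measurableEmbedding Subtype.val_injective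
  rw [himg, hdim, key]
  have hres : (μH[(Module.finrank ℝ H : ℝ)] : Measure (EuclideanSpace ℝ (Fin (k+1)))).restrict A
      = (Measure.map (Subtype.val : H → EuclideanSpace ℝ (Fin (k+1))) μH[(Module.finrank ℝ H : ℝ)]).restrict A := by
    rw [hiso.map_hausdorffMeasure (Or.inl (by positivity)), Measure.restrict_restrict hA,
      inter_eq_left.2]
    rw [hAB]; exact image_subset_range _ _
  rw [hres, hme.restrict_map, hme.lintegral_map]
  refine lintegral_congr fun x => ?_
  congr 1
  rw [hfin, ← Submodule.coe_norm, Real.sqrt_eq_rpow, ← Real.rpow_neg (by positivity),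
    ← Real.rpow_natCast, ← Real.rpow_mul (by positivity)]
  congr 1
  push_cast
  ring
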